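/- arXiv:math/0510627 — 15 statements merged into one kernel-verified Lean document; each statement's English description precedes it below -/
import Mathlib

section
/- Let I be an open real interval, a₀ : I → ℝ differentiable, b₀ : I → ℝ continuous, and α, β : I → ℝ twice differentiable functions satisfying the EID system α'' + (b₀ − a₀)α − 2a₀β' − βa₀' = 0 and β'' + (b₀ − a₀)β + 2α' = 0 on I. If y : I → ℝ is three times differentiable and satisfies y'' + a₀y = 0 on I, then the function z = βy' + αy is twice differentiable and satisfies z'' + b₀z = 0 on I. -/
open Real Set

/-- The direct EID transformation z = βy' + αy maps solutions of y'' + a₀y = 0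
to solutions of z'' + b₀z = 0, provided α, β satisfy the EID system. -/
theorem stmt1 (a b : ℝ) (a₀ b₀ α β y : ℝ → ℝ)
    (ha₀ : ∀ x ∈ Ioo a b, DifferentiableAt ℝ a₀ x)
    (hb₀ : ContinuousOn b₀ (Ioo a b))
    (hα : ∀ x ∈ Ioo a b, DifferentiableAt ℝ α x)
    (hα' : ∀ x ∈ Ioo a b, DifferentiableAt ℝ (deriv α) x)
    (hβ : ∀ x ∈ Ioo a b, DifferentiableAt ℝ β x)
    (hβ' : ∀ x ∈ Ioo a b, DifferentiableAt ℝ (deriv β) x)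
    (heid1 : ∀ x ∈ Ioo a b,
      deriv (deriv α) x + (b₀ x - a₀ x) * α x - 2 * a₀ x * deriv β x
        - β x * deriv a₀ x = 0)
    (heid2 : ∀ x ∈ Ioo a b,
      deriv (deriv β) x + (b₀ x - a₀ x) * β x + 2 * deriv α x = 0)
    (hy : ∀ x ∈ Ioo a b, DifferentiableAt ℝ y x)
    (hy' : ∀ x ∈ Ioo a b, DifferentiableAt ℝ (deriv y) x)
    (hy'' : ∀ x ∈ Ioo a b, DifferentiableAt ℝ (deriv (deriv y)) x)
    (hode : ∀ x ∈ Ioo a b, deriv (deriv y) x + a₀ x * y x = 0) :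
    (∀ x ∈ Ioo a b,
      DifferentiableAt ℝ (fun t => β t * deriv y t + α t * y t) x) ∧
    (∀ x ∈ Ioo a b,
      DifferentiableAt ℝ (deriv (fun t => β t * deriv y t + α t * y t)) x) ∧
    (∀ x ∈ Ioo a b,
      deriv (deriv (fun t => β t * deriv y t + α t * y t)) x +
        b₀ x * (β x * deriv y x + α x * y x) = 0) := by
  have hz : ∀ x ∈ Ioo a b, HasDerivAt (fun t => β t * deriv y t + α t * y t)
      (deriv β x * deriv y x + β x * deriv (deriv y) x
        + (deriv α x * y x + α x * deriv y x)) x := fun x hx =>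
    ((hβ x hx).hasDerivAt.mul (hy' x hx).hasDerivAt).add
      ((hα x hx).hasDerivAt.mul (hy x hx).hasDerivAt)
  have hy3 : ∀ x ∈ Ioo a b, HasDerivAt (deriv (deriv y))
      (-(deriv a₀ x * y x + a₀ x * deriv y x)) x := fun x hx =>
    ((ha₀ x hx).hasDerivAt.mul (hy x hx).hasDerivAt).neg.congr_of_eventuallyEq <| by
      filter_upwards [isOpen_Ioo.mem_nhds hx] with t ht
      exact eq_neg_of_add_eq_zero_left (hode t ht)
  have hz' : ∀ x ∈ Ioo a b, HasDerivAt (deriv (fun t => β t * deriv y t + α t * y t))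
      (deriv (deriv β) x * deriv y x + deriv β x * deriv (deriv y) x
        + (deriv β x * deriv (deriv y) x
          + β x * -(deriv a₀ x * y x + a₀ x * deriv y x))
        + (deriv (deriv α) x * y x + deriv α x * deriv y x
          + (deriv α x * deriv y x + α x * deriv (deriv y) x))) x := fun x hx =>
    ((((hβ' x hx).hasDerivAt.mul (hy' x hx).hasDerivAt).add
      ((hβ x hx).hasDerivAt.mul (hy3 x hx))).add
      (((hα' x hx).hasDerivAt.mul (hy x hx).hasDerivAt).add
        ((hα x hx).hasDerivAt.mul (hy' x hx).hasDerivAt))).congr_of_eventuallyEq <| by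
      filter_upwards [isOpen_Ioo.mem_nhds hx] with t ht
      exact (hz t ht).deriv
  refine ⟨fun x hx => (hz x hx).differentiableAt,
    fun x hx => (hz' x hx).differentiableAt, fun x hx => ?_⟩
  rw [(hz' x hx).deriv]
  linear_combination y x * heid1 x hx + deriv y x * heid2 x hx
    + (2 * deriv β x + α x) * hode x hx
end

section
/- Let I be an open real interval, a₀ : I → ℝ differentiable, b₀ : I → ℝ continuous, and α, β : I → ℝ twice differentiable. Define the 2×2 matrix-valued functions A = [[0, 1], [−a₀, 0]], B = [[0, 1], [−b₀, 0]], and T = [[α, β], [α' − βa₀, α + β']]. Then T is differentiable and satisfies the matrix differential equation T' = B·T − T·A on I if and only if α and β satisfy the EID system α'' + (b₀ − a₀)α − 2a₀β' − βa₀' = 0 and β'' + (b₀ − a₀)β + 2α' = 0 on I. -/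
open Real Set

/-- The matrix of the EID transformation acting on (y, y'). -/
noncomputable def Tmat (a₀ α β : ℝ → ℝ) (x : ℝ) : Matrix (Fin 2) (Fin 2) ℝ :=
  !![α x, β x; deriv α x - β x * a₀ x, α x + deriv β x]

/-- The companion matrix of the equation y'' + a₀y = 0. -/
def companionMat (a₀ : ℝ → ℝ) (x : ℝ) : Matrix (Fin 2) (Fin 2) ℝ :=
  !![0, 1; -a₀ x, 0]

theorem hasDerivAt_Tmat {a₀ α β : ℝ → ℝ} {x : ℝ} (ha₀ : DifferentiableAt ℝ a₀ x)
    (hα : DifferentiableAt ℝ α x) (hα' : DifferentiableAt ℝ (deriv α) x)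
    (hβ : DifferentiableAt ℝ β x) (hβ' : DifferentiableAt ℝ (deriv β) x) (i j : Fin 2) :
    HasDerivAt (fun t => Tmat a₀ α β t i j)
      (!![deriv α x, deriv β x;
        deriv (deriv α) x - (deriv β x * a₀ x + β x * deriv a₀ x),
        deriv α x + deriv (deriv β) x] i j) x := by
  fin_cases i <;> fin_cases j
  · exact hα.hasDerivAt
  · exact hβ.hasDerivAt
  · exact hα'.hasDerivAt.sub (hβ.hasDerivAt.mul ha₀.hasDerivAt)
  · exact hα.hasDerivAt.add hβ'.hasDerivAt

/-- T (entrywise) is differentiable and satisfies T' = B·T − T·A on I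
iff α, β satisfy the EID system. -/
theorem stmt2 (a b : ℝ) (a₀ b₀ α β : ℝ → ℝ)
    (ha₀ : ∀ x ∈ Ioo a b, DifferentiableAt ℝ a₀ x)
    (hb₀ : ContinuousOn b₀ (Ioo a b))
    (hα : ∀ x ∈ Ioo a b, DifferentiableAt ℝ α x)
    (hα' : ∀ x ∈ Ioo a b, DifferentiableAt ℝ (deriv α) x)
    (hβ : ∀ x ∈ Ioo a b, DifferentiableAt ℝ β x)
    (hβ' : ∀ x ∈ Ioo a b, DifferentiableAt ℝ (deriv β) x) :
    ((∀ i j : Fin 2, ∀ x ∈ Ioo a b,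
        DifferentiableAt ℝ (fun t => Tmat a₀ α β t i j) x) ∧
      (∀ x ∈ Ioo a b, ∀ i j : Fin 2,
        deriv (fun t => Tmat a₀ α β t i j) x =
          (companionMat b₀ x * Tmat a₀ α β x
            - Tmat a₀ α β x * companionMat a₀ x) i j)) ↔
    ((∀ x ∈ Ioo a b,
        deriv (deriv α) x + (b₀ x - a₀ x) * α x - 2 * a₀ x * deriv β x
          - β x * deriv a₀ x = 0) ∧
      (∀ x ∈ Ioo a b,
        deriv (deriv β) x + (b₀ x - a₀ x) * β x + 2 * deriv α x = 0)) := by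
  have key := fun x hx => hasDerivAt_Tmat (ha₀ x hx) (hα x hx) (hα' x hx) (hβ x hx) (hβ' x hx)
  rw [and_iff_right fun i j x hx => (key x hx i j).differentiableAt, ← forall₂_and]
  refine forall₂_congr fun x hx => ?_
  simp only [fun i j => (key x hx i j).deriv]
  simp only [Tmat, companionMat, Fin.forall_fin_two, Matrix.sub_apply, Matrix.mul_apply,
    Fin.sum_univ_two, Matrix.of_apply, Matrix.cons_val_zero, Matrix.cons_val_one,
    Matrix.cons_val', Matrix.cons_val_fin_one]
  constructor
  · rintro ⟨-, h₁, h₂⟩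
    constructor <;> linarith
  · rintro ⟨h₁, h₂⟩
    refine ⟨⟨?_, ?_⟩, ?_, ?_⟩ <;> linarith
end

section
/- Let I be an open real interval, a₀ : I → ℝ differentiable, b₀ : I → ℝ continuous, and α, β : I → ℝ twice differentiable functions satisfying the EID system α'' + (b₀ − a₀)α − 2a₀β' − βa₀' = 0 and β'' + (b₀ − a₀)β + 2α' = 0 on I. Then the function K(x) = α(x)β'(x) − β(x)α'(x) + α(x)² + a₀(x)β(x)² has derivative identically zero on I; in particular K is constant on I (a first integral of the EID system). -/
open Real Set

/-- The expression K = αβ' − βα' + α² + a₀β² is a first integral of the EID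
system: its derivative vanishes identically on I, hence K is constant on I. -/
theorem stmt3 (a b : ℝ) (a₀ b₀ α β : ℝ → ℝ)
    (ha₀ : ∀ x ∈ Ioo a b, DifferentiableAt ℝ a₀ x)
    (hb₀ : ContinuousOn b₀ (Ioo a b))
    (hα : ∀ x ∈ Ioo a b, DifferentiableAt ℝ α x)
    (hα' : ∀ x ∈ Ioo a b, DifferentiableAt ℝ (deriv α) x)
    (hβ : ∀ x ∈ Ioo a b, DifferentiableAt ℝ β x)
    (hβ' : ∀ x ∈ Ioo a b, DifferentiableAt ℝ (deriv β) x)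
    (heid1 : ∀ x ∈ Ioo a b,
      deriv (deriv α) x + (b₀ x - a₀ x) * α x - 2 * a₀ x * deriv β x
        - β x * deriv a₀ x = 0)
    (heid2 : ∀ x ∈ Ioo a b,
      deriv (deriv β) x + (b₀ x - a₀ x) * β x + 2 * deriv α x = 0) :
    (∀ x ∈ Ioo a b,
      HasDerivAt (fun t => α t * deriv β t - β t * deriv α t + (α t) ^ 2
        + a₀ t * (β t) ^ 2) 0 x) ∧
    (∀ x ∈ Ioo a b, ∀ y ∈ Ioo a b,
      α x * deriv β x - β x * deriv α x + (α x) ^ 2 + a₀ x * (β x) ^ 2 =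
        α y * deriv β y - β y * deriv α y + (α y) ^ 2 + a₀ y * (β y) ^ 2) := by
  have hK : ∀ x ∈ Ioo a b,
      HasDerivAt (fun t => α t * deriv β t - β t * deriv α t + (α t) ^ 2
        + a₀ t * (β t) ^ 2) 0 x := by
    intro x hx
    have dα := (hα x hx).hasDerivAt
    have dβ := (hβ x hx).hasDerivAt
    have h := (((dα.fun_mul (hβ' x hx).hasDerivAt).fun_sub
      (dβ.fun_mul (hα' x hx).hasDerivAt)).fun_add (dα.fun_pow 2)).fun_add
      ((ha₀ x hx).hasDerivAt.fun_mul (dβ.fun_pow 2))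
    refine h.congr_deriv ?_
    push_cast
    linear_combination α x * heid2 x hx - β x * heid1 x hx
  exact ⟨hK, fun x hx y hy => isOpen_Ioo.is_const_of_deriv_eq_zero isPreconnected_Ioo
    (fun z hz => (hK z hz).differentiableAt.differentiableWithinAt)
    (fun z hz => (hK z hz).deriv) hx hy⟩
end

section
/- Let I be an open real interval, a₀ : I → ℝ differentiable, b₀ : I → ℝ differentiable, and α, β : I → ℝ twice differentiable functions satisfying the EID system α'' + (b₀ − a₀)α − 2a₀β' − βa₀' = 0 and β'' + (b₀ − a₀)β + 2α' = 0 on I. Suppose the first integral K = αβ' − βα' + α² + a₀β² is a nonzero constant K ≠ 0 on I. If z : I → ℝ is three times differentiable and satisfies z'' + b₀z = 0 on I, then the function y = ((α + β')z − βz')/K is twice differentiable and satisfies y'' + a₀y = 0 on I (the inverse EID transformation). -/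
open Real Set

/-- The inverse EID transformation y = ((α + β')z − βz')/K maps solutions of
z'' + b₀z = 0 back to solutions of y'' + a₀y = 0, when α, β satisfy the EID
system and the first integral is a nonzero constant K. -/
theorem stmt5 (a b K : ℝ) (a₀ b₀ α β z : ℝ → ℝ)
    (ha₀ : ∀ x ∈ Ioo a b, DifferentiableAt ℝ a₀ x)
    (hb₀ : ∀ x ∈ Ioo a b, DifferentiableAt ℝ b₀ x)
    (hα : ∀ x ∈ Ioo a b, DifferentiableAt ℝ α x)
    (hα' : ∀ x ∈ Ioo a b, DifferentiableAt ℝ (deriv α) x)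
    (hβ : ∀ x ∈ Ioo a b, DifferentiableAt ℝ β x)
    (hβ' : ∀ x ∈ Ioo a b, DifferentiableAt ℝ (deriv β) x)
    (heid1 : ∀ x ∈ Ioo a b,
      deriv (deriv α) x + (b₀ x - a₀ x) * α x - 2 * a₀ x * deriv β x
        - β x * deriv a₀ x = 0)
    (heid2 : ∀ x ∈ Ioo a b,
      deriv (deriv β) x + (b₀ x - a₀ x) * β x + 2 * deriv α x = 0)
    (hKval : ∀ x ∈ Ioo a b,
      α x * deriv β x - β x * deriv α x + (α x) ^ 2 + a₀ x * (β x) ^ 2 = K)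
    (hK : K ≠ 0)
    (hz : ∀ x ∈ Ioo a b, DifferentiableAt ℝ z x)
    (hz' : ∀ x ∈ Ioo a b, DifferentiableAt ℝ (deriv z) x)
    (hz'' : ∀ x ∈ Ioo a b, DifferentiableAt ℝ (deriv (deriv z)) x)
    (hode : ∀ x ∈ Ioo a b, deriv (deriv z) x + b₀ x * z x = 0) :
    (∀ x ∈ Ioo a b,
      DifferentiableAt ℝ
        (fun t => ((α t + deriv β t) * z t - β t * deriv z t) / K) x) ∧
    (∀ x ∈ Ioo a b,
      DifferentiableAt ℝ
        (deriv (fun t => ((α t + deriv β t) * z t - β t * deriv z t) / K)) x) ∧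
    (∀ x ∈ Ioo a b,
      deriv (deriv (fun t => ((α t + deriv β t) * z t - β t * deriv z t) / K)) x
        + a₀ x * (((α x + deriv β x) * z x - β x * deriv z x) / K) = 0) := by
  have hy : ∀ x ∈ Ioo a b,
      HasDerivAt (fun t => ((α t + deriv β t) * z t - β t * deriv z t) / K)
        (((a₀ x * β x - deriv α x) * z x + α x * deriv z x) / K) x := by
    intro x hx
    have h := (((((hα x hx).hasDerivAt.fun_add (hβ' x hx).hasDerivAt).fun_mul
      (hz x hx).hasDerivAt).fun_sub
      ((hβ x hx).hasDerivAt.fun_mul (hz' x hx).hasDerivAt)).div_const K)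
    refine h.congr_deriv ?_
    linear_combination (z x * heid2 x hx - β x * hode x hx) / K
  have hy' : ∀ x ∈ Ioo a b,
      HasDerivAt (deriv (fun t => ((α t + deriv β t) * z t - β t * deriv z t) / K))
        (-a₀ x * (((α x + deriv β x) * z x - β x * deriv z x) / K)) x := by
    intro x hx
    have h := ((((((ha₀ x hx).hasDerivAt.fun_mul (hβ x hx).hasDerivAt).fun_sub
      (hα' x hx).hasDerivAt).fun_mul (hz x hx).hasDerivAt).fun_add
      ((hα x hx).hasDerivAt.fun_mul (hz' x hx).hasDerivAt)).div_const K)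
    have heq : deriv (fun t => ((α t + deriv β t) * z t - β t * deriv z t) / K)
        =ᶠ[nhds x] fun t => ((a₀ t * β t - deriv α t) * z t + α t * deriv z t) / K :=
      Filter.eventuallyEq_of_mem (isOpen_Ioo.mem_nhds hx) fun t ht => (hy t ht).deriv
    refine (h.congr_of_eventuallyEq heq).congr_deriv ?_
    linear_combination (-z x * heid1 x hx + α x * hode x hx) / K
  refine ⟨fun x hx => (hy x hx).differentiableAt,
    fun x hx => (hy' x hx).differentiableAt, fun x hx => ?_⟩
  rw [(hy' x hx).deriv]
  ring
end

section
/- Let I be an open real interval, a₀ : I → ℝ, and α, β : I → ℝ differentiable functions. Define the first-order operators P f = βf' + αf and Q g = βg' − (α + β')g, and set K(x) = α(x)β'(x) − β(x)α'(x) + α(x)² + a₀(x)β(x)². Then for every twice differentiable f : I → ℝ and every x ∈ I, β(x)²·(f''(x) + a₀(x)f(x)) = Q(Pf)(x) + K(x)·f(x), i.e. β²(D² + a₀) = QP + K as operators on twice differentiable functions. -/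
open Real Set

/-- The operator identity β²(D² + a₀) = QP + K, where P = βD + α,
Q = βD − α − β' and K = αβ' − βα' + α² + a₀β². -/
theorem stmt6 (a b : ℝ) (a₀ α β f : ℝ → ℝ)
    (hα : ∀ x ∈ Ioo a b, DifferentiableAt ℝ α x)
    (hβ : ∀ x ∈ Ioo a b, DifferentiableAt ℝ β x)
    (hf : ∀ x ∈ Ioo a b, DifferentiableAt ℝ f x)
    (hf' : ∀ x ∈ Ioo a b, DifferentiableAt ℝ (deriv f) x) :
    ∀ x ∈ Ioo a b,
      (β x) ^ 2 * (deriv (deriv f) x + a₀ x * f x) =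
        (fun g : ℝ → ℝ => fun t => β t * deriv g t - (α t + deriv β t) * g t)
            ((fun g : ℝ → ℝ => fun t => β t * deriv g t + α t * g t) f) x +
          (α x * deriv β x - β x * deriv α x + (α x) ^ 2 + a₀ x * (β x) ^ 2)
            * f x := by
  intro x hx
  have h : deriv (fun t => β t * deriv f t + α t * f t) x =
      deriv β x * deriv f x + β x * deriv (deriv f) x + (deriv α x * f x + α x * deriv f x) :=
    (((hβ x hx).hasDerivAt.mul (hf' x hx).hasDerivAt).add
      ((hα x hx).hasDerivAt.mul (hf x hx).hasDerivAt)).deriv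
  simp only [h]
  ring
end

section
/- Let I be an open real interval, a₀, b₀ : I → ℝ, and α, β : I → ℝ twice differentiable functions satisfying β'' + (b₀ − a₀)β + 2α' = 0 on I. Define the first-order operators P f = βf' + αf and Q g = βg' − (α + β')g, and set K(x) = α(x)β'(x) − β(x)α'(x) + α(x)² + a₀(x)β(x)². Then for every twice differentiable f : I → ℝ and every x ∈ I, β(x)²·(f''(x) + b₀(x)f(x)) = P(Qf)(x) + K(x)·f(x), i.e. β²(D² + b₀) = PQ + K as operators on twice differentiable functions. -/
open Real Set

/-- The operator identity β²(D² + b₀) = PQ + K, where P = βD + α,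
Q = βD − α − β', K = αβ' − βα' + α² + a₀β², given the EID equation
β'' + (b₀ − a₀)β + 2α' = 0. -/
theorem stmt7 (a b : ℝ) (a₀ b₀ α β f : ℝ → ℝ)
    (hα : ∀ x ∈ Ioo a b, DifferentiableAt ℝ α x)
    (hα' : ∀ x ∈ Ioo a b, DifferentiableAt ℝ (deriv α) x)
    (hβ : ∀ x ∈ Ioo a b, DifferentiableAt ℝ β x)
    (hβ' : ∀ x ∈ Ioo a b, DifferentiableAt ℝ (deriv β) x)
    (heid2 : ∀ x ∈ Ioo a b,
      deriv (deriv β) x + (b₀ x - a₀ x) * β x + 2 * deriv α x = 0)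
    (hf : ∀ x ∈ Ioo a b, DifferentiableAt ℝ f x)
    (hf' : ∀ x ∈ Ioo a b, DifferentiableAt ℝ (deriv f) x) :
    ∀ x ∈ Ioo a b,
      (β x) ^ 2 * (deriv (deriv f) x + b₀ x * f x) =
        (fun g : ℝ → ℝ => fun t => β t * deriv g t + α t * g t)
            ((fun g : ℝ → ℝ => fun t => β t * deriv g t - (α t + deriv β t) * g t) f) x +
          (α x * deriv β x - β x * deriv α x + (α x) ^ 2 + a₀ x * (β x) ^ 2)
            * f x := by
  intro x hx
  have hQ : HasDerivAt (fun t => β t * deriv f t - (α t + deriv β t) * f t)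
      (deriv β x * deriv f x + β x * deriv (deriv f) x -
        ((deriv α x + deriv (deriv β) x) * f x + (α x + deriv β x) * deriv f x)) x :=
    ((hβ x hx).hasDerivAt.mul (hf' x hx).hasDerivAt).sub
      (((hα x hx).hasDerivAt.add (hβ' x hx).hasDerivAt).mul (hf x hx).hasDerivAt)
  simp only [hQ.deriv]
  linear_combination β x * f x * heid2 x hx
end

section
/- Let I be an open real interval, a₀ : I → ℝ differentiable, and λ ∈ ℝ. Let ỹ : I → ℝ be twice differentiable, nonvanishing on I, and satisfy ỹ'' + (a₀ − λ)ỹ = 0 on I. If y₀ : I → ℝ is three times differentiable and satisfies y₀'' + a₀y₀ = 0 on I, then the function y₁ = y₀' − (ỹ'/ỹ)·y₀ is twice differentiable and satisfies y₁'' + (a₀ + 2(ỹ'/ỹ)')y₁ = 0 on I. -/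
open Real Set

/-- The logarithmic derivative of a nonvanishing solution of `y'' + q y = 0` satisfies the
Riccati equation `v' = -q - v²`. -/
theorem hasDerivAt_logDeriv_of_ode {y : ℝ → ℝ} {q x : ℝ} (hy : DifferentiableAt ℝ y x)
    (hy' : DifferentiableAt ℝ (deriv y) x) (hne : y x ≠ 0)
    (hode : deriv (deriv y) x + q * y x = 0) :
    HasDerivAt (fun t => deriv y t / y t) (-q - (deriv y x / y x) ^ 2) x := by
  refine (hy'.hasDerivAt.fun_div hy.hasDerivAt hne).congr_deriv ?_
  rw [eq_neg_of_add_eq_zero_left hode]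
  field_simp

/-- One step of the EID generation process: if ỹ is a nonvanishing solution of
ỹ'' + (a₀ − λ)ỹ = 0 and y₀ solves y₀'' + a₀y₀ = 0, then
y₁ = y₀' − (ỹ'/ỹ)y₀ solves y₁'' + (a₀ + 2(ỹ'/ỹ)')y₁ = 0. -/
theorem stmt10 (a b lam : ℝ) (a₀ ytil y₀ : ℝ → ℝ)
    (ha₀ : ∀ x ∈ Ioo a b, DifferentiableAt ℝ a₀ x)
    (hyt : ∀ x ∈ Ioo a b, DifferentiableAt ℝ ytil x)
    (hyt' : ∀ x ∈ Ioo a b, DifferentiableAt ℝ (deriv ytil) x)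
    (hne : ∀ x ∈ Ioo a b, ytil x ≠ 0)
    (heig : ∀ x ∈ Ioo a b,
      deriv (deriv ytil) x + (a₀ x - lam) * ytil x = 0)
    (hy₀ : ∀ x ∈ Ioo a b, DifferentiableAt ℝ y₀ x)
    (hy₀' : ∀ x ∈ Ioo a b, DifferentiableAt ℝ (deriv y₀) x)
    (hy₀'' : ∀ x ∈ Ioo a b, DifferentiableAt ℝ (deriv (deriv y₀)) x)
    (hode : ∀ x ∈ Ioo a b, deriv (deriv y₀) x + a₀ x * y₀ x = 0) :
    (∀ x ∈ Ioo a b,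
      DifferentiableAt ℝ (fun t => deriv y₀ t - deriv ytil t / ytil t * y₀ t) x) ∧
    (∀ x ∈ Ioo a b,
      DifferentiableAt ℝ
        (deriv (fun t => deriv y₀ t - deriv ytil t / ytil t * y₀ t)) x) ∧
    (∀ x ∈ Ioo a b,
      deriv (deriv (fun t => deriv y₀ t - deriv ytil t / ytil t * y₀ t)) x
        + (a₀ x + 2 * deriv (fun t => deriv ytil t / ytil t) x) *
          (deriv y₀ x - deriv ytil x / ytil x * y₀ x) = 0) := by
  set v : ℝ → ℝ := fun t => deriv ytil t / ytil t with hv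
  set y₁ : ℝ → ℝ := fun t => deriv y₀ t - deriv ytil t / ytil t * y₀ t with hy₁
  have hv' : ∀ x ∈ Ioo a b, HasDerivAt v (-(a₀ x - lam) - v x ^ 2) x := fun x hx =>
    hasDerivAt_logDeriv_of_ode (hyt x hx) (hyt' x hx) (hne x hx) (heig x hx)
  have hy₁' : ∀ x ∈ Ioo a b, HasDerivAt y₁ (-lam * y₀ x - v x * y₁ x) x := fun x hx => by
    refine ((hy₀' x hx).hasDerivAt.fun_sub
      ((hv' x hx).fun_mul (hy₀ x hx).hasDerivAt)).congr_deriv ?_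
    simp only [hy₁, hv]
    linear_combination hode x hx
  have hy₁'' : ∀ x ∈ Ioo a b, HasDerivAt (deriv y₁)
      (-lam * deriv y₀ x -
        ((-(a₀ x - lam) - v x ^ 2) * y₁ x + v x * (-lam * y₀ x - v x * y₁ x))) x :=
    fun x hx => by
      refine HasDerivAt.congr_of_eventuallyEq
        (((hy₀ x hx).hasDerivAt.const_mul (-lam)).fun_sub ((hv' x hx).fun_mul (hy₁' x hx))) ?_
      filter_upwards [isOpen_Ioo.mem_nhds hx] with t ht using (hy₁' t ht).deriv
  refine ⟨fun x hx => (hy₁' x hx).differentiableAt, fun x hx => (hy₁'' x hx).differentiableAt,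
    fun x hx => ?_⟩
  rw [(hy₁'' x hx).deriv, (hv' x hx).deriv]
  simp only [hy₁, hv]
  ring
end

section
/- Let I be an open real interval, n ≥ 1 a natural number, w : I → ℝ an n-times continuously differentiable function that is nonvanishing on I, and f : I → ℝ an n-times continuously differentiable function. For each integer k ≥ 1 define the operator L_k by (L_k g)(x) = g'(x) − k·(w'(x)/w(x))·g(x), and define the operator M by (M g)(x) = (g/w)'(x). Then (L_n ∘ L_{n−1} ∘ ⋯ ∘ L_1)(f)(x) = w(x)ⁿ · (Mⁿ f)(x) for all x ∈ I, i.e. the product ∏_{k=n}^{1}(D − k·w'/w) equals wⁿ(D∘(1/w))ⁿ as operators. -/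
open Real Set

/-- The first-order operator L_k : g ↦ g' − k·(w'/w)·g. -/
noncomputable def Lop (w : ℝ → ℝ) (k : ℕ) (g : ℝ → ℝ) : ℝ → ℝ :=
  fun x => deriv g x - (k : ℝ) * (deriv w x / w x) * g x

/-- The composition L_n ∘ L_{n−1} ∘ ⋯ ∘ L_1 applied to f. -/
noncomputable def Lchain (w : ℝ → ℝ) : ℕ → (ℝ → ℝ) → (ℝ → ℝ)
  | 0, f => f
  | (k + 1), f => Lop w (k + 1) (Lchain w k f)

/-- The first-order operator `g ↦ (g / w)'`. -/
noncomputable def derivDiv (w g : ℝ → ℝ) : ℝ → ℝ :=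
  fun s => deriv (fun t => g t / w t) s

theorem contDiffOn_derivDiv {s : Set ℝ} (hs : IsOpen s) {w g : ℝ → ℝ} {m : ℕ}
    (hw : ContDiffOn ℝ (m + 1 : ℕ) w s) (hwne : ∀ x ∈ s, w x ≠ 0)
    (hg : ContDiffOn ℝ (m + 1 : ℕ) g s) : ContDiffOn ℝ m (derivDiv w g) s := by
  have h := hg.div hw hwne
  rw [Nat.cast_succ] at h
  exact ((contDiffOn_succ_iff_deriv_of_isOpen hs).1 h).2.2

theorem contDiffOn_iterate_derivDiv {s : Set ℝ} (hs : IsOpen s) {w f : ℝ → ℝ} {k m : ℕ}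
    (hw : ContDiffOn ℝ (m + k : ℕ) w s) (hwne : ∀ x ∈ s, w x ≠ 0)
    (hf : ContDiffOn ℝ (m + k : ℕ) f s) : ContDiffOn ℝ m ((derivDiv w)^[k] f) s := by
  induction k generalizing m with
  | zero => exact hf
  | succ k ih =>
    rw [Function.iterate_succ_apply']
    have e : m + (k + 1) = m + 1 + k := by omega
    rw [e] at hw hf
    exact contDiffOn_derivDiv hs (hw.of_le (by exact_mod_cast (by omega))) hwne (ih hw hf)

theorem Lop_pow_mul {w g : ℝ → ℝ} {x : ℝ} (k : ℕ) (hw : DifferentiableAt ℝ w x)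
    (hx : w x ≠ 0) (hg : DifferentiableAt ℝ g x) :
    Lop w (k + 1) (fun t => w t ^ k * g t) x = w x ^ (k + 1) * derivDiv w g x := by
  have hprod := ((hw.hasDerivAt.fun_pow k).fun_mul hg.hasDerivAt).deriv
  have hquot := (hg.hasDerivAt.fun_div hw.hasDerivAt hx).deriv
  simp only [Lop, derivDiv, hprod, hquot]
  cases k with
  | zero => simp; field_simp
  | succ k => simp only [Nat.add_sub_cancel]; push_cast; field_simp; ring

theorem Lchain_eq_pow_mul_iterate {s : Set ℝ} (hs : IsOpen s) {w f : ℝ → ℝ} {n : ℕ}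
    (hw : ContDiffOn ℝ n w s) (hwne : ∀ x ∈ s, w x ≠ 0) (hf : ContDiffOn ℝ n f s) :
    ∀ x ∈ s, Lchain w n f x = w x ^ n * (derivDiv w)^[n] f x := by
  induction n with
  | zero => simp [Lchain]
  | succ k ih =>
    intro x hx
    have hk : ((k : ℕ) : WithTop ℕ∞) ≤ (k + 1 : ℕ) := by exact_mod_cast k.le_succ
    have ih' := ih (hw.of_le hk) (hf.of_le hk)
    have hnhds := hs.mem_nhds hx
    have heq : Lchain w k f =ᶠ[nhds x] fun t => w t ^ k * (derivDiv w)^[k] f t :=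
      Filter.eventually_of_mem hnhds ih'
    have hg : ContDiffOn ℝ (1 : ℕ) ((derivDiv w)^[k] f) s :=
      contDiffOn_iterate_derivDiv hs (by rwa [add_comm]) hwne (by rwa [add_comm])
    rw [Function.iterate_succ_apply', ← Lop_pow_mul k
      ((hw.contDiffAt hnhds).differentiableAt (by simp)) (hwne x hx)
      ((hg.contDiffAt hnhds).differentiableAt (by simp))]
    simp only [Lchain, Lop, heq.deriv_eq, heq.eq_of_nhds]

/-- The operational identity ∏_{k=n}^{1}(D − k·w'/w) = wⁿ(D∘(1/w))ⁿ, where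
(D∘(1/w))g = (g/w)'. -/
theorem stmt11 (a b : ℝ) (n : ℕ) (hn : 1 ≤ n) (w f : ℝ → ℝ)
    (hw : ContDiffOn ℝ n w (Ioo a b))
    (hwne : ∀ x ∈ Ioo a b, w x ≠ 0)
    (hf : ContDiffOn ℝ n f (Ioo a b)) :
    ∀ x ∈ Ioo a b,
      Lchain w n f x =
        w x ^ n *
          ((fun g : ℝ → ℝ => fun s => deriv (fun t => g t / w t) s)^[n] f) x := by
  exact Lchain_eq_pow_mul_iterate isOpen_Ioo hw hwne hf
end

section
/- Let I be an open real interval, n ≥ 0 a natural number, w : I → ℝ an (n+1)-times continuously differentiable function that is nonvanishing on I, and f : I → ℝ an (n+1)-times continuously differentiable function. For each integer k ≥ 0 define the operator L_k by (L_k g)(x) = g'(x) − k·(w'(x)/w(x))·g(x) (so L_0 = D), and define the operator N by (N g)(x) = g'(x)/w(x). Then (L_n ∘ L_{n−1} ∘ ⋯ ∘ L_1 ∘ L_0)(f)(x) = w(x)^{n+1} · (N^{n+1} f)(x) for all x ∈ I, i.e. ∏_{k=n}^{0}(D − k·w'/w) = w^{n+1}((1/w)D)^{n+1} as operators. -/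
open Real Set

/-- The composition L_n ∘ L_{n−1} ∘ ⋯ ∘ L_1 ∘ L_0 applied to f. -/
noncomputable def Lchain0 (w : ℝ → ℝ) : ℕ → (ℝ → ℝ) → (ℝ → ℝ)
  | 0, f => Lop w 0 f
  | (k + 1), f => Lop w (k + 1) (Lchain0 w k f)

theorem contDiffOn_iterate_deriv_div {s : Set ℝ} (hs : IsOpen s) {N : ℕ} {w f : ℝ → ℝ}
    (hw : ContDiffOn ℝ N w s) (hwne : ∀ x ∈ s, w x ≠ 0) (hf : ContDiffOn ℝ N f s)
    (m j : ℕ) (hmj : j + m = N) :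
    ContDiffOn ℝ j ((fun g : ℝ → ℝ => fun s => deriv g s / w s)^[m] f) s := by
  induction m generalizing j with
  | zero =>
    obtain rfl : j = N := by omega
    exact hf
  | succ m ih =>
    rw [Function.iterate_succ_apply']
    have hd := (ih (j + 1) (by omega)).deriv_of_isOpen (m := j) hs (by norm_cast)
    exact hd.div (hw.of_le (by norm_cast; omega)) hwne

theorem Lop_pow_mul_s12 {s : Set ℝ} (hs : IsOpen s) {w g h : ℝ → ℝ} {k : ℕ} {x : ℝ} (hx : x ∈ s)
    (hwx : w x ≠ 0) (hw : DifferentiableAt ℝ w x) (hg : DifferentiableAt ℝ g x)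
    (hh : ∀ y ∈ s, h y = w y ^ k * g y) :
    Lop w k h x = w x ^ (k + 1) * (deriv g x / w x) := by
  have hev : h =ᶠ[nhds x] fun y => w y ^ k * g y :=
    Filter.eventuallyEq_of_mem (hs.mem_nhds hx) hh
  have hd := ((hw.hasDerivAt.fun_pow k).fun_mul hg.hasDerivAt).deriv
  rw [Lop, hev.deriv_eq, hh x hx, hd]
  cases k with
  | zero => simp; field_simp
  | succ k =>
    simp only [Nat.add_sub_cancel]
    field_simp
    ring

/-- The operational identity ∏_{k=n}^{0}(D − k·w'/w) = w^{n+1}((1/w)D)^{n+1},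
where ((1/w)D)g = g'/w. -/
theorem stmt12 (a b : ℝ) (n : ℕ) (w f : ℝ → ℝ)
    (hw : ContDiffOn ℝ (n + 1) w (Ioo a b))
    (hwne : ∀ x ∈ Ioo a b, w x ≠ 0)
    (hf : ContDiffOn ℝ (n + 1) f (Ioo a b)) :
    ∀ x ∈ Ioo a b,
      Lchain0 w n f x =
        w x ^ (n + 1) *
          ((fun g : ℝ → ℝ => fun s => deriv g s / w s)^[n + 1] f) x := by
  have hs : IsOpen (Ioo a b) := isOpen_Ioo
  have hreg := contDiffOn_iterate_deriv_div (N := n + 1) hs (by exact_mod_cast hw) hwne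
    (by exact_mod_cast hf)
  have hwd : ∀ x ∈ Ioo a b, DifferentiableAt ℝ w x := fun x hx =>
    (hw.differentiableOn (by norm_cast)).differentiableAt (hs.mem_nhds hx)
  have hgd (m : ℕ) (hm : m ≤ n) (x : ℝ) (hx : x ∈ Ioo a b) : DifferentiableAt ℝ
      ((fun g : ℝ → ℝ => fun s => deriv g s / w s)^[m] f) x :=
    ((hreg m (n + 1 - m) (by omega)).differentiableOn
      (by norm_cast; omega)).differentiableAt (hs.mem_nhds hx)
  suffices H : ∀ k ≤ n, ∀ x ∈ Ioo a b, Lchain0 w k f x =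
      w x ^ (k + 1) * ((fun g : ℝ → ℝ => fun s => deriv g s / w s)^[k + 1] f) x from
    H n le_rfl
  intro k
  induction k with
  | zero =>
    intro hk x hx
    exact Lop_pow_mul_s12 hs hx (hwne x hx) (hwd x hx) (hgd 0 hk x hx) (by simp)
  | succ k ih =>
    intro hk x hx
    rw [Function.iterate_succ_apply']
    exact Lop_pow_mul_s12 hs hx (hwne x hx) (hwd x hx) (hgd (k + 1) hk x hx) (ih (by omega))
end

section
/- Let λ ∈ ℝ, n a natural number, and let y₀ : ℝ → ℝ be a smooth function satisfying y₀'' = λ·y₀ on ℝ. On the interval I = (0, ∞) define g₀ = y₀ and g_{j+1}(x) = g_j'(x)/x for 0 ≤ j ≤ n, and set y_n(x) = x^{n+1}·g_{n+1}(x). Then y_n is twice differentiable on I and satisfies y_n''(x) − (λ + n(n+1)/x²)·y_n(x) = 0 for all x ∈ I. -/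
open Real Set

theorem ContDiffOn.deriv_div_id {g : ℝ → ℝ} (hg : ContDiffOn ℝ (⊤ : ℕ∞) g (Ioi 0)) :
    ContDiffOn ℝ (⊤ : ℕ∞) (fun s => deriv g s / s) (Ioi 0) :=
  (hg.deriv_of_isOpen isOpen_Ioi (by simp)).div contDiffOn_id fun _ hx => ne_of_gt hx

theorem ContDiffOn.hasDerivAt_Ioi {g : ℝ → ℝ} {a x : ℝ}
    (hg : ContDiffOn ℝ (⊤ : ℕ∞) g (Ioi a)) (hx : a < x) : HasDerivAt g (deriv g x) x :=
  ((hg.differentiableOn (by simp)).differentiableAt (Ioi_mem_nhds hx)).hasDerivAt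

theorem ContDiffOn.hasDerivAt_deriv_Ioi {g : ℝ → ℝ} {a x : ℝ}
    (hg : ContDiffOn ℝ (⊤ : ℕ∞) g (Ioi a)) (hx : a < x) :
    HasDerivAt (deriv g) (deriv (deriv g) x) x :=
  (hg.deriv_of_isOpen (n := (⊤ : ℕ∞)) (m := (⊤ : ℕ∞)) isOpen_Ioi (by simp)).hasDerivAt_Ioi hx

/-- If `x g'' + c g' = lam x g` on `(0, ∞)`, then `h = g' / x` satisfies
`x h'' + (c + 2) h' = lam x h` there. -/
theorem ode_deriv_div_id {lam c : ℝ} {g : ℝ → ℝ}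
    (hg : ContDiffOn ℝ (⊤ : ℕ∞) g (Ioi 0))
    (hode : ∀ x : ℝ, 0 < x → x * deriv (deriv g) x + c * deriv g x = lam * x * g x)
    {x : ℝ} (hx : 0 < x) :
    x * deriv (deriv fun s => deriv g s / s) x + (c + 2) * deriv (fun s => deriv g s / s) x
      = lam * x * (deriv g x / x) := by
  set h : ℝ → ℝ := fun s => deriv g s / s with hh
  have hsmooth : ContDiffOn ℝ (⊤ : ℕ∞) h (Ioi 0) := hg.deriv_div_id
  have first_order : ∀ t : ℝ, 0 < t → t * deriv h t + (c + 1) * h t = lam * g t := by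
    intro t ht
    have hd : deriv h t = (deriv (deriv g) t * t - deriv g t * 1) / t ^ 2 :=
      ((hg.hasDerivAt_deriv_Ioi ht).div (hasDerivAt_id t) ht.ne').deriv
    have e := hode t ht
    rw [hd, hh]
    field_simp
    linear_combination e
  have hl := ((hasDerivAt_id x).mul (hsmooth.hasDerivAt_deriv_Ioi hx)).add
    ((hsmooth.hasDerivAt_Ioi hx).const_mul (c + 1))
  have hr := (hg.hasDerivAt_Ioi hx).const_mul lam
  have e := hl.unique (hr.congr_of_eventuallyEq
    (Filter.eventuallyEq_of_mem (Ioi_mem_nhds hx) first_order))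
  simp only [id] at e
  have hcancel : lam * x * (deriv g x / x) = lam * deriv g x := by field_simp
  rw [hcancel]
  linear_combination e

theorem iterate_deriv_div_id_ode {lam : ℝ} {y₀ : ℝ → ℝ}
    (hy₀ : ContDiff ℝ (⊤ : ℕ∞) y₀)
    (hode : ∀ x : ℝ, deriv (deriv y₀) x = lam * y₀ x) (k : ℕ) :
    ContDiffOn ℝ (⊤ : ℕ∞) ((fun g : ℝ → ℝ => fun s : ℝ => deriv g s / s)^[k] y₀) (Ioi 0) ∧
      ∀ x : ℝ, 0 < x →
        x * deriv (deriv ((fun g : ℝ → ℝ => fun s : ℝ => deriv g s / s)^[k] y₀)) x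
          + 2 * k * deriv ((fun g : ℝ → ℝ => fun s : ℝ => deriv g s / s)^[k] y₀) x
        = lam * x * ((fun g : ℝ → ℝ => fun s : ℝ => deriv g s / s)^[k] y₀) x := by
  induction k with
  | zero =>
    refine ⟨hy₀.contDiffOn, fun x _ => ?_⟩
    simp only [Function.iterate_zero, id, hode]
    push_cast
    ring
  | succ k ih =>
    rw [Function.iterate_succ_apply']
    refine ⟨ih.1.deriv_div_id, fun x hx => ?_⟩
    have e := ode_deriv_div_id ih.1 ih.2 hx
    push_cast
    linear_combination e

/-- The function y_n = x^{n+1}·((1/x)D)^{n+1} y₀ solves the Schrödinger-type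
equation y'' − (λ + n(n+1)/x²)y = 0 on (0, ∞), where y₀'' = λy₀. -/
theorem stmt13 (lam : ℝ) (n : ℕ) (y₀ : ℝ → ℝ)
    (hy₀ : ContDiff ℝ (⊤ : ℕ∞) y₀)
    (hode : ∀ x : ℝ, deriv (deriv y₀) x = lam * y₀ x) :
    (∀ x ∈ Ioi (0 : ℝ),
      DifferentiableAt ℝ
        (fun t : ℝ => t ^ (n + 1) *
          ((fun g : ℝ → ℝ => fun s : ℝ => deriv g s / s)^[n + 1] y₀) t) x) ∧
    (∀ x ∈ Ioi (0 : ℝ),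
      DifferentiableAt ℝ
        (deriv (fun t : ℝ => t ^ (n + 1) *
          ((fun g : ℝ → ℝ => fun s : ℝ => deriv g s / s)^[n + 1] y₀) t)) x) ∧
    (∀ x ∈ Ioi (0 : ℝ),
      deriv (deriv (fun t : ℝ => t ^ (n + 1) *
          ((fun g : ℝ → ℝ => fun s : ℝ => deriv g s / s)^[n + 1] y₀) t)) x
        - (lam + (n : ℝ) * ((n : ℝ) + 1) / x ^ 2) *
          (x ^ (n + 1) *
            ((fun g : ℝ → ℝ => fun s : ℝ => deriv g s / s)^[n + 1] y₀) x) = 0) := by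
  obtain ⟨hg, hgode⟩ := iterate_deriv_div_id_ode hy₀ hode (n + 1)
  set g := (fun g : ℝ → ℝ => fun s : ℝ => deriv g s / s)^[n + 1] y₀
  have hd : ∀ x ∈ Ioi (0 : ℝ), HasDerivAt (fun t : ℝ => t ^ (n + 1) * g t)
      (((n + 1 : ℕ) : ℝ) * x ^ n * g x + x ^ (n + 1) * deriv g x) x := fun x hx =>
    (hasDerivAt_pow (n + 1) x).mul (hg.hasDerivAt_Ioi hx)
  have hdd : ∀ x ∈ Ioi (0 : ℝ), HasDerivAt (deriv fun t : ℝ => t ^ (n + 1) * g t)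
      ((lam + (n : ℝ) * ((n : ℝ) + 1) / x ^ 2) * (x ^ (n + 1) * g x)) x := by
    intro x hx
    have hx0 : x ≠ 0 := ne_of_gt hx
    have hformula := ((((hasDerivAt_pow n x).const_mul ((n + 1 : ℕ) : ℝ)).mul
      (hg.hasDerivAt_Ioi hx)).add
      ((hasDerivAt_pow (n + 1) x).mul (hg.hasDerivAt_deriv_Ioi hx))).congr_of_eventuallyEq
      (Filter.eventuallyEq_of_mem (Ioi_mem_nhds hx) fun t ht => (hd t ht).deriv)
    refine hformula.congr_deriv ?_
    have e := hgode x hx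
    have hpow : (n : ℝ) * x ^ (n - 1) = n * x ^ n / x := by
      cases n with
      | zero => simp
      | succ m => field_simp; simp [pow_succ]
    rw [hpow]
    push_cast at e ⊢
    simp only [pow_succ]
    field_simp
    linear_combination x * e
  exact ⟨fun x hx => (hd x hx).differentiableAt, fun x hx => (hdd x hx).differentiableAt,
    fun x hx => by rw [(hdd x hx).deriv, sub_self]⟩
end

section
/- Let λ ∈ ℝ, n a natural number, and let y₀ : ℝ → ℝ be a smooth function satisfying y₀'' = λ·y₀ on ℝ. Define g₀ = y₀ and g_{j+1}(x) = g_j'(x)/cosh(x) for 0 ≤ j ≤ n, and set y_n(x) = cosh(x)^{n+1}·g_{n+1}(x). Then y_n is twice differentiable on ℝ and satisfies y_n''(x) − (λ − n(n+1)/cosh²(x))·y_n(x) = 0 for all x ∈ ℝ. -/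
open Real Set

/-- `u'' = (lam - a (a + 1) / cosh² x) u` on `ℝ`, with `v = u'`. -/
def IsPoschlTellerSolution (lam a : ℝ) (u v : ℝ → ℝ) : Prop :=
  (∀ x, HasDerivAt u (v x) x) ∧
    ∀ x, HasDerivAt v ((lam - a * (a + 1) / Real.cosh x ^ 2) * u x) x

/-- The Darboux step with seed `cosh ^ (a + 1)` raises the parameter `a` by one. -/
theorem IsPoschlTellerSolution.darboux {lam a : ℝ} {u v : ℝ → ℝ}
    (h : IsPoschlTellerSolution lam a u v) :
    IsPoschlTellerSolution lam (a + 1)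
      (fun x => v x - (a + 1) * (Real.sinh x / Real.cosh x) * u x)
      (fun x => (lam - (a + 1) ^ 2 / Real.cosh x ^ 2) * u x
        - (a + 1) * (Real.sinh x / Real.cosh x) * v x) := by
  obtain ⟨hu, hv⟩ := h
  have htanh (x : ℝ) := (Real.hasDerivAt_sinh x).fun_div (Real.hasDerivAt_cosh x)
    (Real.cosh_pos x).ne'
  refine ⟨fun x => ?_, fun x => ?_⟩
  · have hc := (Real.cosh_pos x).ne'
    refine ((hv x).fun_sub (((htanh x).const_mul (a + 1)).fun_mul (hu x))).congr_deriv ?_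
    field_simp
    linear_combination (-(a + 1) * u x) * Real.cosh_sq x
  · have hc := (Real.cosh_pos x).ne'
    have hq := ((hasDerivAt_const x ((a + 1) ^ 2)).fun_div
      ((Real.hasDerivAt_cosh x).fun_pow 2) (pow_ne_zero 2 hc)).const_sub lam
    refine ((hq.fun_mul (hu x)).fun_sub
      (((htanh x).const_mul (a + 1)).fun_mul (hv x))).congr_deriv ?_
    push_cast
    field_simp
    linear_combination (-(a + 1) * v x * Real.cosh x) * Real.cosh_sq x

theorem exists_isPoschlTellerSolution_iterate {lam : ℝ} {y : ℝ → ℝ}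
    (hy : ContDiff ℝ (⊤ : ℕ∞) y) (hode : ∀ x, deriv (deriv y) x = lam * y x) (n : ℕ) :
    ∃ v, IsPoschlTellerSolution lam n
      (fun t => Real.cosh t ^ (n + 1) *
        ((fun g : ℝ → ℝ => fun s : ℝ => deriv g s / Real.cosh s)^[n + 1] y) t) v := by
  induction n with
  | zero =>
    have hd : Differentiable ℝ y := hy.differentiable (by simp)
    have hd' : Differentiable ℝ (deriv y) :=
      (contDiff_infty_iff_deriv.1 hy).2.differentiable (by simp)
    have hfun : (fun t => Real.cosh t ^ (0 + 1) *
        ((fun g : ℝ → ℝ => fun s : ℝ => deriv g s / Real.cosh s)^[0 + 1] y) t) = deriv y := by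
      funext t
      have hc := (Real.cosh_pos t).ne'
      simp only [zero_add, Function.iterate_one, pow_one]
      field_simp
    rw [hfun]
    refine ⟨fun x => lam * y x, fun x => ?_, fun x => ?_⟩
    · simpa only [hode x] using (hd' x).hasDerivAt
    · exact ((hd x).hasDerivAt.const_mul lam).congr_deriv (by simp)
  | succ n ih =>
    obtain ⟨v, h⟩ := ih
    have hfun : (fun t => Real.cosh t ^ (n + 1 + 1) *
        ((fun g : ℝ → ℝ => fun s : ℝ => deriv g s / Real.cosh s)^[n + 1 + 1] y) t) =
        fun t => v t - ((n : ℝ) + 1) * (Real.sinh t / Real.cosh t) * (Real.cosh t ^ (n + 1) *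
          ((fun g : ℝ → ℝ => fun s : ℝ => deriv g s / Real.cosh s)^[n + 1] y) t) := by
      funext t
      rw [Function.iterate_succ_apply']
      have hu := h.1 t
      generalize (fun g : ℝ → ℝ => fun s : ℝ => deriv g s / Real.cosh s)^[n + 1] y = G at hu ⊢
      have hc := (Real.cosh_pos t).ne'
      have hG : G = fun s => Real.cosh s ^ (n + 1) * G s / Real.cosh s ^ (n + 1) := by
        funext s
        have hs := (Real.cosh_pos s).ne'
        field_simp
      have hG' := hu.fun_div ((Real.hasDerivAt_cosh t).fun_pow (n + 1)) (pow_ne_zero _ hc)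
      rw [← hG] at hG'
      rw [hG'.deriv]
      push_cast
      field_simp
      ring
    rw [hfun, Nat.cast_succ]
    exact ⟨_, h.darboux⟩

/-- The function y_n = cosh^{n+1}(x)·((1/cosh x)D)^{n+1} y₀ solves the
Schrödinger equation y'' − (λ − n(n+1)/cosh²x)y = 0 on ℝ, where y₀'' = λy₀. -/
theorem stmt14 (lam : ℝ) (n : ℕ) (y₀ : ℝ → ℝ)
    (hy₀ : ContDiff ℝ (⊤ : ℕ∞) y₀)
    (hode : ∀ x : ℝ, deriv (deriv y₀) x = lam * y₀ x) :
    (∀ x : ℝ,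
      DifferentiableAt ℝ
        (fun t : ℝ => Real.cosh t ^ (n + 1) *
          ((fun g : ℝ → ℝ => fun s : ℝ => deriv g s / Real.cosh s)^[n + 1] y₀) t) x) ∧
    (∀ x : ℝ,
      DifferentiableAt ℝ
        (deriv (fun t : ℝ => Real.cosh t ^ (n + 1) *
          ((fun g : ℝ → ℝ => fun s : ℝ => deriv g s / Real.cosh s)^[n + 1] y₀) t)) x) ∧
    (∀ x : ℝ,
      deriv (deriv (fun t : ℝ => Real.cosh t ^ (n + 1) *
          ((fun g : ℝ → ℝ => fun s : ℝ => deriv g s / Real.cosh s)^[n + 1] y₀) t)) x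
        - (lam - (n : ℝ) * ((n : ℝ) + 1) / Real.cosh x ^ 2) *
          (Real.cosh x ^ (n + 1) *
            ((fun g : ℝ → ℝ => fun s : ℝ => deriv g s / Real.cosh s)^[n + 1] y₀) x) = 0) := by
  obtain ⟨v, hu, hv⟩ := exists_isPoschlTellerSolution_iterate hy₀ hode n
  have hderiv := funext fun x => (hu x).deriv
  refine ⟨fun x => (hu x).differentiableAt, fun x => ?_, fun x => ?_⟩
  · rw [hderiv]
    exact (hv x).differentiableAt
  · rw [hderiv, (hv x).deriv, sub_self]
end

section
/- Let λ ∈ ℝ, n a natural number, and let y₀ : ℝ → ℝ be a smooth function satisfying y₀'' = λ·y₀ on ℝ. On the interval I = (0, π) define g₀ = y₀ and g_{j+1}(x) = g_j'(x)/sin(x) for 0 ≤ j ≤ n, and set y_n(x) = sin(x)^{n+1}·g_{n+1}(x). Then y_n is twice differentiable on I and satisfies y_n''(x) − (λ + n(n+1)/sin²(x))·y_n(x) = 0 for all x ∈ I. -/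
open Real Set

/-- On `(0, π)`, `g` is smooth and satisfies
`sin x · g'' + 2 m cos x · g' = (m² + lam) sin x · g`. -/
structure SolvesSinODE (lam m : ℝ) (g : ℝ → ℝ) : Prop where
  contDiffOn : ContDiffOn ℝ (⊤ : ℕ∞) g (Ioo 0 Real.pi)
  ode : ∀ x ∈ Ioo (0 : ℝ) Real.pi,
    Real.sin x * deriv (deriv g) x + 2 * m * Real.cos x * deriv g x =
      (m ^ 2 + lam) * Real.sin x * g x

theorem ContDiffOn.deriv_Ioo {a b : ℝ} {g : ℝ → ℝ}
    (hg : ContDiffOn ℝ (⊤ : ℕ∞) g (Ioo a b)) :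
    ContDiffOn ℝ (⊤ : ℕ∞) (deriv g) (Ioo a b) :=
  hg.deriv_of_isOpen isOpen_Ioo (by simp)

theorem ContDiffOn.hasDerivAt_Ioo {a b : ℝ} {g : ℝ → ℝ}
    (hg : ContDiffOn ℝ (⊤ : ℕ∞) g (Ioo a b)) {x : ℝ} (hx : x ∈ Ioo a b) :
    HasDerivAt g (deriv g x) x :=
  ((hg.differentiableOn (by simp)).differentiableAt (isOpen_Ioo.mem_nhds hx)).hasDerivAt

theorem SolvesSinODE.deriv_div_sin {lam m : ℝ} {g : ℝ → ℝ} (hg : SolvesSinODE lam m g) :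
    SolvesSinODE lam (m + 1) (fun s : ℝ => deriv g s / Real.sin s) := by
  have hsin : ∀ x ∈ Ioo (0 : ℝ) Real.pi, Real.sin x ≠ 0 :=
    fun x hx => (Real.sin_pos_of_mem_Ioo hx).ne'
  have hh : ContDiffOn ℝ (⊤ : ℕ∞) (fun s : ℝ => deriv g s / Real.sin s) (Ioo 0 Real.pi) :=
    hg.contDiffOn.deriv_Ioo.div Real.contDiff_sin.contDiffOn hsin
  refine ⟨hh, fun x hx => ?_⟩
  set h : ℝ → ℝ := fun s : ℝ => deriv g s / Real.sin s with h_def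
  have first_order : ∀ t ∈ Ioo (0 : ℝ) Real.pi,
      Real.sin t * deriv h t = (m ^ 2 + lam) * g t - (2 * m + 1) * (Real.cos t * h t) := by
    intro t ht
    have hs := hsin t ht
    have hd : deriv h t = _ :=
      ((hg.contDiffOn.deriv_Ioo.hasDerivAt_Ioo ht).div (Real.hasDerivAt_sin t) hs).deriv
    have ho := hg.ode t ht
    rw [hd, h_def]
    field_simp
    linear_combination ho
  have hl := (Real.hasDerivAt_sin x).mul (hh.deriv_Ioo.hasDerivAt_Ioo hx)
  have hr := ((hg.contDiffOn.hasDerivAt_Ioo hx).const_mul (m ^ 2 + lam)).sub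
    (((Real.hasDerivAt_cos x).mul (hh.hasDerivAt_Ioo hx)).const_mul (2 * m + 1))
  have heq := hl.unique (hr.congr_of_eventuallyEq
    (Filter.eventually_of_mem (isOpen_Ioo.mem_nhds hx) first_order))
  have hgh : deriv g x = Real.sin x * h x := by
    have hs := hsin x hx
    rw [h_def]
    field_simp
  rw [hgh] at heq
  linear_combination heq

theorem SolvesSinODE.iterate {lam : ℝ} {g : ℝ → ℝ} (hg : SolvesSinODE lam 0 g) (k : ℕ) :
    SolvesSinODE lam k ((fun g : ℝ → ℝ => fun s : ℝ => deriv g s / Real.sin s)^[k] g) := by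
  induction k with
  | zero => simpa using hg
  | succ k ih =>
    rw [Function.iterate_succ_apply', Nat.cast_succ]
    exact ih.deriv_div_sin

/-- If `g` solves the equation with parameter `n + 1`, then `sin^{n+1} · g` solves the
Schrödinger equation with potential `lam + n (n + 1) / sin²`. -/
theorem SolvesSinODE.deriv_deriv_sin_pow_mul {lam : ℝ} {n : ℕ} {g : ℝ → ℝ}
    (hg : SolvesSinODE lam (n + 1) g) {x : ℝ} (hx : x ∈ Ioo (0 : ℝ) Real.pi) :
    deriv (deriv (fun t : ℝ => Real.sin t ^ (n + 1) * g t)) x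
      - (lam + (n : ℝ) * ((n : ℝ) + 1) / Real.sin x ^ 2) * (Real.sin x ^ (n + 1) * g x) = 0 := by
  have hd : ∀ t ∈ Ioo (0 : ℝ) Real.pi,
      deriv (fun t : ℝ => Real.sin t ^ (n + 1) * g t) t =
        Real.sin t ^ n * (((n : ℝ) + 1) * (Real.cos t * g t) + Real.sin t * deriv g t) := by
    intro t ht
    have ht' := (((Real.hasDerivAt_sin t).pow (n + 1)).mul (hg.contDiffOn.hasDerivAt_Ioo ht)).deriv
    refine ht'.trans ?_
    simp only [Pi.pow_apply, Nat.add_sub_cancel, Nat.cast_succ]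
    ring
  have h2 := ((Real.hasDerivAt_sin x).pow n).mul
    ((((Real.hasDerivAt_cos x).mul (hg.contDiffOn.hasDerivAt_Ioo hx)).const_mul ((n : ℝ) + 1)).add
      ((Real.hasDerivAt_sin x).mul (hg.contDiffOn.deriv_Ioo.hasDerivAt_Ioo hx)))
  have hdd : deriv (deriv (fun t : ℝ => Real.sin t ^ (n + 1) * g t)) x = _ :=
    (h2.congr_of_eventuallyEq
      (Filter.eventually_of_mem (isOpen_Ioo.mem_nhds hx) hd)).deriv
  have hs : Real.sin x ≠ 0 := (Real.sin_pos_of_mem_Ioo hx).ne'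
  have ho := hg.ode x hx
  have hcs := Real.sin_sq_add_cos_sq x
  rw [hdd]
  simp only [Pi.pow_apply, Pi.mul_apply, Pi.add_apply]
  cases n with
  | zero =>
    simp at ho ⊢
    linear_combination ho
  | succ k =>
    simp only [Nat.add_sub_cancel, Nat.cast_succ] at ho ⊢
    field_simp
    linear_combination Real.sin x ^ (k + 2) *
      (Real.sin x * ho + ((k : ℝ) + 1) * ((k : ℝ) + 2) * g x * hcs)

/-- The function y_n = sin^{n+1}(x)·((1/sin x)D)^{n+1} y₀ solves the
Schrödinger equation y'' − (λ + n(n+1)/sin²x)y = 0 on (0, π), where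
y₀'' = λy₀. -/
theorem stmt16 (lam : ℝ) (n : ℕ) (y₀ : ℝ → ℝ)
    (hy₀ : ContDiff ℝ (⊤ : ℕ∞) y₀)
    (hode : ∀ x : ℝ, deriv (deriv y₀) x = lam * y₀ x) :
    (∀ x ∈ Ioo (0 : ℝ) Real.pi,
      DifferentiableAt ℝ
        (fun t : ℝ => Real.sin t ^ (n + 1) *
          ((fun g : ℝ → ℝ => fun s : ℝ => deriv g s / Real.sin s)^[n + 1] y₀) t) x) ∧
    (∀ x ∈ Ioo (0 : ℝ) Real.pi,
      DifferentiableAt ℝ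
        (deriv (fun t : ℝ => Real.sin t ^ (n + 1) *
          ((fun g : ℝ → ℝ => fun s : ℝ => deriv g s / Real.sin s)^[n + 1] y₀) t)) x) ∧
    (∀ x ∈ Ioo (0 : ℝ) Real.pi,
      deriv (deriv (fun t : ℝ => Real.sin t ^ (n + 1) *
          ((fun g : ℝ → ℝ => fun s : ℝ => deriv g s / Real.sin s)^[n + 1] y₀) t)) x
        - (lam + (n : ℝ) * ((n : ℝ) + 1) / Real.sin x ^ 2) *
          (Real.sin x ^ (n + 1) *
            ((fun g : ℝ → ℝ => fun s : ℝ => deriv g s / Real.sin s)^[n + 1] y₀) x) = 0) := by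
  have h0 : SolvesSinODE lam 0 y₀ :=
    ⟨hy₀.contDiffOn, fun x _ => by rw [hode x]; ring⟩
  have hg := h0.iterate (n + 1)
  have hy := (Real.contDiff_sin.pow (n + 1)).contDiffOn.mul hg.contDiffOn
  refine ⟨fun x hx => (hy.hasDerivAt_Ioo hx).differentiableAt,
    fun x hx => (hy.deriv_Ioo.hasDerivAt_Ioo hx).differentiableAt, fun x hx => ?_⟩
  rw [Nat.cast_succ] at hg
  exact hg.deriv_deriv_sin_pow_mul hx
end

section
/- Let λ, m ∈ ℝ, a > 0, b > 0, n a natural number, and let y₀ : ℝ → ℝ be a smooth function satisfying y₀'' = λ·y₀ on ℝ. Set w(x) = a·e^{mx} + b·e^{−mx} (which is positive on ℝ). Define g₀ = y₀ and g_{j+1}(x) = g_j'(x)/w(x) for 0 ≤ j ≤ n, and set y_n(x) = w(x)^{n+1}·g_{n+1}(x). Then y_n is twice differentiable on ℝ and satisfies y_n''(x) − (λ − 4abm²n(n+1)/w(x)²)·y_n(x) = 0 for all x ∈ ℝ. -/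
open Real Set

/-- Darboux step: if `y'' = (l - n(n+1)q) y` and `u' = q`, `q' = -2uq`, then
`z = y' - (n+1)uy` satisfies `z'' = (l - (n+1)(n+2)q) z`. -/
theorem darboux_step {l n : ℝ} {y y' u q : ℝ → ℝ}
    (hy : ∀ x, HasDerivAt y (y' x) x)
    (hy' : ∀ x, HasDerivAt y' ((l - n * (n + 1) * q x) * y x) x)
    (hu : ∀ x, HasDerivAt u (q x) x) (hq : ∀ x, HasDerivAt q (-2 * u x * q x) x) :
    ∃ z' : ℝ → ℝ, (∀ x, HasDerivAt (fun t => y' t - (n + 1) * (u t * y t)) (z' x) x) ∧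
      ∀ x, HasDerivAt z' ((l - (n + 1) * (n + 1 + 1) * q x) *
        (y' x - (n + 1) * (u x * y x))) x := by
  refine ⟨fun t => (l - (n + 1) ^ 2 * q t) * y t - (n + 1) * (u t * y' t), fun x => ?_,
    fun x => ?_⟩
  · refine ((hy' x).sub (((hu x).mul (hy x)).const_mul (n + 1))).congr_deriv ?_
    ring
  · refine (((((hq x).const_mul ((n + 1) ^ 2)).const_sub l).mul (hy x)).sub
      (((hu x).mul (hy' x)).const_mul (n + 1))).congr_deriv ?_
    ring

/-- If `y₀'' = l y₀`, `w'' = c w` and `c w² - w'² = K`, then `y = w^(n+1) ((1/w) D)^(n+1) y₀`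
satisfies `y'' = (l - n(n+1) K / w²) y`. -/
theorem iterate_deriv_div_ode {l c K : ℝ} {w w' y₀ : ℝ → ℝ} (hw0 : ∀ x, w x ≠ 0)
    (hw : ∀ x, HasDerivAt w (w' x) x) (hw' : ∀ x, HasDerivAt w' (c * w x) x)
    (hK : ∀ x, c * w x ^ 2 - w' x ^ 2 = K)
    (h0 : ∀ x, HasDerivAt y₀ (deriv y₀ x) x)
    (h1 : ∀ x, HasDerivAt (deriv y₀) (l * y₀ x) x) (n : ℕ) :
    ∃ y' : ℝ → ℝ,
      (∀ x, HasDerivAt (fun t => w t ^ (n + 1) *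
        (fun g : ℝ → ℝ => fun s : ℝ => deriv g s / w s)^[n + 1] y₀ t) (y' x) x) ∧
      ∀ x, HasDerivAt y' ((l - n * (n + 1) * (K / w x ^ 2)) * (w x ^ (n + 1) *
        (fun g : ℝ → ℝ => fun s : ℝ => deriv g s / w s)^[n + 1] y₀ x)) x := by
  have hu : ∀ x, HasDerivAt (fun t => w' t / w t) (K / w x ^ 2) x := fun x => by
    refine ((hw' x).div (hw x) (hw0 x)).congr_deriv ?_
    rw [← hK x]
    ring
  have hq : ∀ x, HasDerivAt (fun t => K / w t ^ 2) (-2 * (w' x / w x) * (K / w x ^ 2)) x :=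
    fun x => by
    have := hw0 x
    refine ((hasDerivAt_const x K).div ((hw x).pow 2) (pow_ne_zero 2 this)).congr_deriv ?_
    simp only [Pi.pow_apply]
    field_simp
    simp
    ring
  induction n with
  | zero =>
    refine ⟨fun x => l * y₀ x, fun x => ?_, fun x => ?_⟩
    · convert h1 x using 1
      funext t
      have := hw0 t
      simp
      field_simp
    · have := hw0 x
      refine ((h0 x).const_mul l).congr_deriv ?_
      simp [mul_div_cancel₀ _ this]
  | succ n ih =>
    obtain ⟨y', hy, hy'⟩ := ih
    have hz := darboux_step hy hy' hu hq
    have key : ∀ t, w t ^ (n + 1 + 1) *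
        (fun g : ℝ → ℝ => fun s : ℝ => deriv g s / w s)^[n + 1 + 1] y₀ t =
        y' t - ((n : ℝ) + 1) * (w' t / w t * (w t ^ (n + 1) *
        (fun g : ℝ → ℝ => fun s : ℝ => deriv g s / w s)^[n + 1] y₀ t)) := by
      intro t
      rw [Function.iterate_succ_apply']
      generalize (fun g : ℝ → ℝ => fun s : ℝ => deriv g s / w s)^[n + 1] y₀ = g at hy ⊢
      have hg : HasDerivAt g _ t := ((hy t).div ((hw t).pow (n + 1))
        (pow_ne_zero _ (hw0 t))).congr_of_eventuallyEq (.of_forall fun s => by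
          have := hw0 s
          simp only [Pi.div_apply, Pi.pow_apply]
          field_simp)
      have := hw0 t
      simp only [hg.deriv, Pi.pow_apply]
      push_cast
      field_simp
      ring
    simp only [key]
    push_cast
    exact hz

/-- With w(x) = a·e^{mx} + b·e^{−mx} (a, b > 0), the function
y_n = w^{n+1}·((1/w)D)^{n+1} y₀ solves the generalized Schrödinger equation
y'' − (λ − 4abm²n(n+1)/w²)y = 0 on ℝ, where y₀'' = λy₀. -/
theorem stmt17 (lam m a b : ℝ) (ha : 0 < a) (hb : 0 < b) (n : ℕ) (y₀ : ℝ → ℝ)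
    (hy₀ : ContDiff ℝ (⊤ : ℕ∞) y₀)
    (hode : ∀ x : ℝ, deriv (deriv y₀) x = lam * y₀ x) :
    (∀ x : ℝ,
      DifferentiableAt ℝ
        (fun t : ℝ => (a * Real.exp (m * t) + b * Real.exp (-(m * t))) ^ (n + 1) *
          ((fun g : ℝ → ℝ => fun s : ℝ =>
            deriv g s / (a * Real.exp (m * s) + b * Real.exp (-(m * s))))^[n + 1] y₀) t) x) ∧
    (∀ x : ℝ,
      DifferentiableAt ℝ
        (deriv (fun t : ℝ => (a * Real.exp (m * t) + b * Real.exp (-(m * t))) ^ (n + 1) *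
          ((fun g : ℝ → ℝ => fun s : ℝ =>
            deriv g s / (a * Real.exp (m * s) + b * Real.exp (-(m * s))))^[n + 1] y₀) t)) x) ∧
    (∀ x : ℝ,
      deriv (deriv (fun t : ℝ => (a * Real.exp (m * t) + b * Real.exp (-(m * t))) ^ (n + 1) *
          ((fun g : ℝ → ℝ => fun s : ℝ =>
            deriv g s / (a * Real.exp (m * s) + b * Real.exp (-(m * s))))^[n + 1] y₀) t)) x
        - (lam - 4 * a * b * m ^ 2 * (n : ℝ) * ((n : ℝ) + 1) /
            (a * Real.exp (m * x) + b * Real.exp (-(m * x))) ^ 2) *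
          ((a * Real.exp (m * x) + b * Real.exp (-(m * x))) ^ (n + 1) *
            ((fun g : ℝ → ℝ => fun s : ℝ =>
              deriv g s / (a * Real.exp (m * s) + b * Real.exp (-(m * s))))^[n + 1] y₀) x) = 0) := by
  have hE : ∀ x, HasDerivAt (fun t => Real.exp (m * t)) (Real.exp (m * x) * m) x := fun x => by
    simpa using ((hasDerivAt_id x).const_mul m).exp
  have hF : ∀ x, HasDerivAt (fun t => Real.exp (-(m * t))) (Real.exp (-(m * x)) * -m) x :=
    fun x => by simpa using ((hasDerivAt_id x).const_mul m).neg.exp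
  have h0 : Differentiable ℝ y₀ := hy₀.differentiable (by simp)
  have h1 : Differentiable ℝ (deriv y₀) :=
    (contDiff_infty_iff_deriv.mp hy₀).2.differentiable (by simp)
  obtain ⟨y', hy, hy'⟩ := iterate_deriv_div_ode (l := lam) (c := m ^ 2) (K := 4 * a * b * m ^ 2)
    (w := fun t => a * Real.exp (m * t) + b * Real.exp (-(m * t)))
    (w' := fun t => a * (Real.exp (m * t) * m) + b * (Real.exp (-(m * t)) * -m)) (y₀ := y₀)
    (fun x => by positivity) (fun x => ((hE x).const_mul a).add ((hF x).const_mul b))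
    (fun x => ((((hE x).mul_const m).const_mul a).add
      (((hF x).mul_const (-m)).const_mul b)).congr_deriv (by ring))
    (fun x => by
      have h : Real.exp (m * x) * Real.exp (-(m * x)) = 1 := by simp [← Real.exp_add]
      linear_combination 4 * a * b * m ^ 2 * h)
    (fun x => (h0 x).hasDerivAt) (fun x => hode x ▸ (h1 x).hasDerivAt) n
  rw [show deriv _ = y' from funext fun x => (hy x).deriv]
  refine ⟨fun x => (hy x).differentiableAt, fun x => (hy' x).differentiableAt, fun x => ?_⟩
  rw [(hy' x).deriv]
  ring
end

section
/- Let λ, m, a, b ∈ ℝ, n a natural number, and let y₀ : ℝ → ℝ be a smooth function satisfying y₀'' = λ·y₀ on ℝ. Set w(x) = a·cos(mx) + b·sin(mx), and let I be an open real interval on which w is nonvanishing. Define on I: g₀ = y₀ and g_{j+1}(x) = g_j'(x)/w(x) for 0 ≤ j ≤ n, and set y_n(x) = w(x)^{n+1}·g_{n+1}(x). Then y_n is twice differentiable on I and satisfies y_n''(x) − (λ + m²(a² + b²)n(n+1)/w(x)²)·y_n(x) = 0 for all x ∈ I. -/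
open Real Set

theorem ContDiffOn.hasDerivAt_of_isOpen {s : Set ℝ} (hs : IsOpen s) {f : ℝ → ℝ}
    (hf : ContDiffOn ℝ (⊤ : ℕ∞) f s) {x : ℝ} (hx : x ∈ s) : HasDerivAt f (deriv f x) x :=
  ((hf.differentiableOn (by simp)).differentiableAt (hs.mem_nhds hx)).hasDerivAt

/-- If `G' = w H`, where `w'' = -m² w` and `w G'' + 2 N w' G' = (lam + m² N²) w G`, then `H`
satisfies the same equation with `N + 1` in place of `N`. -/
theorem ode_step {s : Set ℝ} (hs : IsOpen s) {lam m N : ℝ} {w w' G H : ℝ → ℝ}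
    (hw : ∀ x, HasDerivAt w (w' x) x) (hw' : ∀ x, HasDerivAt w' (-m ^ 2 * w x) x)
    (hne : ∀ x ∈ s, w x ≠ 0)
    (hG : ContDiffOn ℝ (⊤ : ℕ∞) G s) (hH : ContDiffOn ℝ (⊤ : ℕ∞) H s)
    (hGH : ∀ x ∈ s, deriv G x = w x * H x)
    (hode : ∀ x ∈ s, w x * deriv (deriv G) x + 2 * N * w' x * deriv G x =
      (lam + m ^ 2 * N ^ 2) * w x * G x) :
    ∀ x ∈ s, w x * deriv (deriv H) x + 2 * (N + 1) * w' x * deriv H x =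
      (lam + m ^ 2 * (N + 1) ^ 2) * w x * H x := by
  have hH' : ContDiffOn ℝ (⊤ : ℕ∞) (deriv H) s := hH.deriv_of_isOpen hs (by simp)
  have hfirst : ∀ x ∈ s, w x * deriv H x + (2 * N + 1) * (w' x * H x) =
      (lam + m ^ 2 * N ^ 2) * G x := by
    intro x hx
    have hG2 : deriv (deriv G) x = w' x * H x + w x * deriv H x :=
      ((hw x).mul (hH.hasDerivAt_of_isOpen hs hx)).congr_of_eventuallyEq
        (Filter.eventually_of_mem (hs.mem_nhds hx) hGH) |>.deriv
    have := hode x hx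
    rw [hG2, hGH x hx] at this
    apply mul_left_cancel₀ (hne x hx)
    linear_combination this
  intro x hx
  have hl := ((hw x).mul (hH'.hasDerivAt_of_isOpen hs hx)).add
    (((hw' x).mul (hH.hasDerivAt_of_isOpen hs hx)).const_mul (2 * N + 1))
  have hr := ((hG.hasDerivAt_of_isOpen hs hx).const_mul
    (lam + m ^ 2 * N ^ 2)).congr_of_eventuallyEq
      (Filter.eventually_of_mem (hs.mem_nhds hx) hfirst)
  have := hl.unique hr
  rw [hGH x hx] at this
  linear_combination this

theorem iterate_deriv_div_ode_s18 {s : Set ℝ} (hs : IsOpen s) {lam m : ℝ} {w w' y : ℝ → ℝ}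
    (hw : ∀ x, HasDerivAt w (w' x) x) (hw' : ∀ x, HasDerivAt w' (-m ^ 2 * w x) x)
    (hwc : ContDiff ℝ (⊤ : ℕ∞) w) (hne : ∀ x ∈ s, w x ≠ 0)
    (hy : ContDiff ℝ (⊤ : ℕ∞) y) (hode : ∀ x, deriv (deriv y) x = lam * y x) (N : ℕ) :
    ContDiffOn ℝ (⊤ : ℕ∞) ((fun g : ℝ → ℝ => fun t => deriv g t / w t)^[N] y) s ∧
    ∀ x ∈ s, w x * deriv (deriv ((fun g : ℝ → ℝ => fun t => deriv g t / w t)^[N] y)) x +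
        2 * N * w' x * deriv ((fun g : ℝ → ℝ => fun t => deriv g t / w t)^[N] y) x =
      (lam + m ^ 2 * N ^ 2) * w x * ((fun g : ℝ → ℝ => fun t => deriv g t / w t)^[N] y) x := by
  induction N with
  | zero =>
    refine ⟨hy.contDiffOn, fun x _ => ?_⟩
    simp only [Function.iterate_zero, id_eq, hode, Nat.cast_zero]
    ring
  | succ N ih =>
    simp only [Function.iterate_succ', Function.comp_apply, Nat.cast_succ]
    generalize (fun g : ℝ → ℝ => fun t => deriv g t / w t)^[N] y = G at ih ⊢
    have hH : ContDiffOn ℝ (⊤ : ℕ∞) (fun t => deriv G t / w t) s :=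
      (ih.1.deriv_of_isOpen hs (by simp)).div hwc.contDiffOn hne
    exact ⟨hH, ode_step hs hw hw' hne ih.1 hH
      (fun x hx => (mul_div_cancel₀ _ (hne x hx)).symm) ih.2⟩

/-- Passing from `G` to `w ^ (n + 1) * G` removes the first-order term. -/
theorem pow_mul_schrodinger {s : Set ℝ} (hs : IsOpen s) {lam m c : ℝ} {w w' G : ℝ → ℝ} (n : ℕ)
    (hw : ∀ x, HasDerivAt w (w' x) x) (hw' : ∀ x, HasDerivAt w' (-m ^ 2 * w x) x)
    (hint : ∀ x, w' x ^ 2 + m ^ 2 * w x ^ 2 = m ^ 2 * c) (hne : ∀ x ∈ s, w x ≠ 0)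
    (hG : ContDiffOn ℝ (⊤ : ℕ∞) G s)
    (hode : ∀ x ∈ s, w x * deriv (deriv G) x + 2 * (n + 1 : ℕ) * w' x * deriv G x =
      (lam + m ^ 2 * (n + 1 : ℕ) ^ 2) * w x * G x) {x : ℝ} (hx : x ∈ s) :
    HasDerivAt (deriv fun t => w t ^ (n + 1) * G t)
      ((lam + m ^ 2 * c * n * (n + 1) / w x ^ 2) * (w x ^ (n + 1) * G x)) x := by
  have hG' : ContDiffOn ℝ (⊤ : ℕ∞) (deriv G) s := hG.deriv_of_isOpen hs (by simp)
  have hy' : ∀ t ∈ s, deriv (fun t => w t ^ (n + 1) * G t) t =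
      w t ^ n * ((n + 1) * (w' t * G t) + w t * deriv G t) := by
    intro t ht
    have := (((hw t).pow (n + 1)).mul (hG.hasDerivAt_of_isOpen hs ht)).deriv
    refine this.trans ?_
    simp only [Pi.pow_apply, Nat.add_sub_cancel]
    push_cast
    ring
  have hd := ((hw x).pow n).mul
    ((((hw' x).mul (hG.hasDerivAt_of_isOpen hs hx)).const_mul ((n : ℝ) + 1)).add
      ((hw x).mul (hG'.hasDerivAt_of_isOpen hs hx)))
  refine (hd.congr_of_eventuallyEq
    (Filter.eventually_of_mem (hs.mem_nhds hx) hy')).congr_deriv ?_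
  have hwx := hne x hx
  have hi := hint x
  have ho := hode x hx
  have hpow : (n : ℝ) * w x ^ (n - 1) = n * w x ^ n / w x := by
    cases n with
    | zero => simp
    | succ k => rw [pow_succ, Nat.add_sub_cancel]; field_simp
  simp only [Pi.pow_apply, Pi.mul_apply, Pi.add_apply, hpow]
  push_cast at ho
  rw [← hi]
  field_simp
  linear_combination w x ^ 2 * w x ^ n * ho

/-- With w(x) = a·cos(mx) + b·sin(mx) nonvanishing on the open interval (p, q),
the function y_n = w^{n+1}·((1/w)D)^{n+1} y₀ solves the generalized Schrödinger
equation y'' − (λ + m²(a² + b²)n(n+1)/w²)y = 0 on (p, q), where y₀'' = λy₀. -/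
theorem stmt18 (lam m a b p q : ℝ) (n : ℕ) (y₀ : ℝ → ℝ)
    (hy₀ : ContDiff ℝ (⊤ : ℕ∞) y₀)
    (hode : ∀ x : ℝ, deriv (deriv y₀) x = lam * y₀ x)
    (hwne : ∀ x ∈ Ioo p q, a * Real.cos (m * x) + b * Real.sin (m * x) ≠ 0) :
    (∀ x ∈ Ioo p q,
      DifferentiableAt ℝ
        (fun t : ℝ => (a * Real.cos (m * t) + b * Real.sin (m * t)) ^ (n + 1) *
          ((fun g : ℝ → ℝ => fun s : ℝ =>
            deriv g s / (a * Real.cos (m * s) + b * Real.sin (m * s)))^[n + 1] y₀) t) x) ∧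
    (∀ x ∈ Ioo p q,
      DifferentiableAt ℝ
        (deriv (fun t : ℝ => (a * Real.cos (m * t) + b * Real.sin (m * t)) ^ (n + 1) *
          ((fun g : ℝ → ℝ => fun s : ℝ =>
            deriv g s / (a * Real.cos (m * s) + b * Real.sin (m * s)))^[n + 1] y₀) t)) x) ∧
    (∀ x ∈ Ioo p q,
      deriv (deriv (fun t : ℝ => (a * Real.cos (m * t) + b * Real.sin (m * t)) ^ (n + 1) *
          ((fun g : ℝ → ℝ => fun s : ℝ =>
            deriv g s / (a * Real.cos (m * s) + b * Real.sin (m * s)))^[n + 1] y₀) t)) x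
        - (lam + m ^ 2 * (a ^ 2 + b ^ 2) * (n : ℝ) * ((n : ℝ) + 1) /
            (a * Real.cos (m * x) + b * Real.sin (m * x)) ^ 2) *
          ((a * Real.cos (m * x) + b * Real.sin (m * x)) ^ (n + 1) *
            ((fun g : ℝ → ℝ => fun s : ℝ =>
              deriv g s / (a * Real.cos (m * s) + b * Real.sin (m * s)))^[n + 1] y₀) x) = 0) := by
  have hw : ∀ x, HasDerivAt (fun t => a * Real.cos (m * t) + b * Real.sin (m * t))
      (m * (b * Real.cos (m * x) - a * Real.sin (m * x))) x := by
    intro x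
    have hm := (hasDerivAt_id x).const_mul m
    refine ((hm.cos.const_mul a).add (hm.sin.const_mul b)).congr_deriv ?_
    simp only [id_eq]
    ring
  have hw' : ∀ x, HasDerivAt (fun t => m * (b * Real.cos (m * t) - a * Real.sin (m * t)))
      (-m ^ 2 * (a * Real.cos (m * x) + b * Real.sin (m * x))) x := by
    intro x
    have hm := (hasDerivAt_id x).const_mul m
    refine (((hm.cos.const_mul b).sub (hm.sin.const_mul a)).const_mul m).congr_deriv ?_
    simp only [id_eq]
    ring
  have hwc : ContDiff ℝ (⊤ : ℕ∞) fun t => a * Real.cos (m * t) + b * Real.sin (m * t) := by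
    fun_prop
  obtain ⟨hG, hGode⟩ := iterate_deriv_div_ode_s18 isOpen_Ioo hw hw' hwc hwne hy₀ hode (n + 1)
  have hint : ∀ x, (m * (b * Real.cos (m * x) - a * Real.sin (m * x))) ^ 2 +
      m ^ 2 * (a * Real.cos (m * x) + b * Real.sin (m * x)) ^ 2 = m ^ 2 * (a ^ 2 + b ^ 2) := by
    intro x
    linear_combination m ^ 2 * (a ^ 2 + b ^ 2) * Real.sin_sq_add_cos_sq (m * x)
  have hy := fun x (hx : x ∈ Ioo p q) =>
    pow_mul_schrodinger isOpen_Ioo n hw hw' hint hwne hG hGode hx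
  refine ⟨fun x hx => ?_, fun x hx => (hy x hx).differentiableAt, fun x hx => ?_⟩
  · exact (((hw x).pow (n + 1)).mul (hG.hasDerivAt_of_isOpen isOpen_Ioo hx)).differentiableAt
  · rw [(hy x hx).deriv, sub_self]
end

section
/- Let λ, c₁, c₂ ∈ ℝ and let I = (0, π), on which x·cos(x) − sin(x) ≠ 0. Define y₂ : I → ℝ by y₂(x) = [c₁·(−λ²x·cos(λx)cos(x) + (λ² − 1)cos(λx)sin(x) − λx·sin(λx)sin(x)) + c₂·(−λ²x·cos(x)sin(λx) + (λ² − 1)sin(λx)sin(x) + λx·cos(λx)sin(x))] / (x·cos(x) − sin(x)). Then y₂ is twice differentiable on I and satisfies y₂''(x) + (λ² − 2(x² − sin²(x))/(x·cos(x) − sin(x))²)·y₂(x) = 0 for all x ∈ I. -/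
open Real Set

theorem hasDerivAt_mul_cos_sub_sin (x : ℝ) :
    HasDerivAt (fun t : ℝ => t * cos t - sin t) (-(x * sin x)) x := by
  refine HasDerivAt.congr_deriv (((hasDerivAt_id x).mul (hasDerivAt_cos x)).sub (hasDerivAt_sin x)) ?_
  simp

/-- First derivative of the twice transformed function built from a function `u` that solves the
harmonic oscillator equation of frequency `lam` and has derivative `v`. -/
theorem hasDerivAt_transformed {lam x : ℝ} {u v : ℝ → ℝ}
    (hu : HasDerivAt u (v x) x) (hv : HasDerivAt v (-(lam ^ 2) * u x) x)
    (hw : x * cos x - sin x ≠ 0) :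
    HasDerivAt (fun t => -(lam ^ 2) * u t + sin t * (t * v t - u t) / (t * cos t - sin t))
      (-(lam ^ 2) * v x + (x - sin x * cos x) * (x * v x - u x) / (x * cos x - sin x) ^ 2
        - lam ^ 2 * (x * sin x * u x) / (x * cos x - sin x)) x := by
  refine HasDerivAt.congr_deriv ((hu.const_mul (-(lam ^ 2))).add
    (((hasDerivAt_sin x).mul (((hasDerivAt_id x).mul hv).sub hu)).div
      (hasDerivAt_mul_cos_sub_sin x) hw)) ?_
  simp only [Pi.mul_apply, Pi.sub_apply, id]
  generalize hW : x * cos x - sin x = w at hw ⊢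
  field_simp
  linear_combination (x * v x - u x) * (x * sin_sq_add_cos_sq x - cos x * hW)

/-- Second derivative of the twice transformed function. -/
theorem hasDerivAt_deriv_transformed {lam x : ℝ} {u v : ℝ → ℝ}
    (hu : HasDerivAt u (v x) x) (hv : HasDerivAt v (-(lam ^ 2) * u x) x)
    (hw : x * cos x - sin x ≠ 0) :
    HasDerivAt (fun t => -(lam ^ 2) * v t
        + (t - sin t * cos t) * (t * v t - u t) / (t * cos t - sin t) ^ 2
        - lam ^ 2 * (t * sin t * u t) / (t * cos t - sin t))
      (-((lam ^ 2 - 2 * (x ^ 2 - sin x ^ 2) / (x * cos x - sin x) ^ 2) *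
        (-(lam ^ 2) * u x + sin x * (x * v x - u x) / (x * cos x - sin x)))) x := by
  have hD := hasDerivAt_mul_cos_sub_sin x
  refine HasDerivAt.congr_deriv (((hv.const_mul (-(lam ^ 2))).add
    ((((hasDerivAt_id x).sub ((hasDerivAt_sin x).mul (hasDerivAt_cos x))).mul
      (((hasDerivAt_id x).mul hv).sub hu)).div (hD.pow 2) (pow_ne_zero 2 hw))).sub
    (((((hasDerivAt_id x).mul (hasDerivAt_sin x)).mul hu).const_mul (lam ^ 2)).div hD hw)) ?_
  simp only [Pi.mul_apply, Pi.sub_apply, Pi.pow_apply, id]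
  generalize hW : x * cos x - sin x = w at hw ⊢
  field_simp
  norm_num only [pow_one]
  linear_combination
    (-(x * v x - u x) * w ^ 2 - lam ^ 2 * x ^ 2 * u x * w ^ 2) * sin_sq_add_cos_sq x
      + (lam ^ 2 * u x * w ^ 2 * (2 * sin x + cos x * x)
        - 2 * sin x ^ 2 * (x * v x - u x) * w) * hW

/-- The explicit general solution y₂ of the equation
y'' + (λ² − 2(x² − sin²x)/(x cos x − sin x)²)y = 0 on (0, π), obtained from
y₀'' + λ²y₀ = 0 by two EID transformations. -/
theorem stmt19 (lam c₁ c₂ : ℝ)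
    (hne : ∀ x ∈ Ioo (0 : ℝ) Real.pi, x * Real.cos x - Real.sin x ≠ 0) :
    (∀ x ∈ Ioo (0 : ℝ) Real.pi,
      DifferentiableAt ℝ
        (fun t : ℝ =>
          (c₁ * (-(lam ^ 2) * t * Real.cos (lam * t) * Real.cos t
              + (lam ^ 2 - 1) * Real.cos (lam * t) * Real.sin t
              - lam * t * Real.sin (lam * t) * Real.sin t)
            + c₂ * (-(lam ^ 2) * t * Real.cos t * Real.sin (lam * t)
              + (lam ^ 2 - 1) * Real.sin (lam * t) * Real.sin t
              + lam * t * Real.cos (lam * t) * Real.sin t)) /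
          (t * Real.cos t - Real.sin t)) x) ∧
    (∀ x ∈ Ioo (0 : ℝ) Real.pi,
      DifferentiableAt ℝ
        (deriv (fun t : ℝ =>
          (c₁ * (-(lam ^ 2) * t * Real.cos (lam * t) * Real.cos t
              + (lam ^ 2 - 1) * Real.cos (lam * t) * Real.sin t
              - lam * t * Real.sin (lam * t) * Real.sin t)
            + c₂ * (-(lam ^ 2) * t * Real.cos t * Real.sin (lam * t)
              + (lam ^ 2 - 1) * Real.sin (lam * t) * Real.sin t
              + lam * t * Real.cos (lam * t) * Real.sin t)) /
          (t * Real.cos t - Real.sin t))) x) ∧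
    (∀ x ∈ Ioo (0 : ℝ) Real.pi,
      deriv (deriv (fun t : ℝ =>
          (c₁ * (-(lam ^ 2) * t * Real.cos (lam * t) * Real.cos t
              + (lam ^ 2 - 1) * Real.cos (lam * t) * Real.sin t
              - lam * t * Real.sin (lam * t) * Real.sin t)
            + c₂ * (-(lam ^ 2) * t * Real.cos t * Real.sin (lam * t)
              + (lam ^ 2 - 1) * Real.sin (lam * t) * Real.sin t
              + lam * t * Real.cos (lam * t) * Real.sin t)) /
          (t * Real.cos t - Real.sin t))) x
        + (lam ^ 2 - 2 * (x ^ 2 - Real.sin x ^ 2) /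
            (x * Real.cos x - Real.sin x) ^ 2) *
          ((c₁ * (-(lam ^ 2) * x * Real.cos (lam * x) * Real.cos x
              + (lam ^ 2 - 1) * Real.cos (lam * x) * Real.sin x
              - lam * x * Real.sin (lam * x) * Real.sin x)
            + c₂ * (-(lam ^ 2) * x * Real.cos x * Real.sin (lam * x)
              + (lam ^ 2 - 1) * Real.sin (lam * x) * Real.sin x
              + lam * x * Real.cos (lam * x) * Real.sin x)) /
          (x * Real.cos x - Real.sin x)) = 0) := by
  set y : ℝ → ℝ := fun t =>
          (c₁ * (-(lam ^ 2) * t * Real.cos (lam * t) * Real.cos t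
              + (lam ^ 2 - 1) * Real.cos (lam * t) * Real.sin t
              - lam * t * Real.sin (lam * t) * Real.sin t)
            + c₂ * (-(lam ^ 2) * t * Real.cos t * Real.sin (lam * t)
              + (lam ^ 2 - 1) * Real.sin (lam * t) * Real.sin t
              + lam * t * Real.cos (lam * t) * Real.sin t)) /
          (t * Real.cos t - Real.sin t) with hy
  set u : ℝ → ℝ := fun t => c₁ * cos (lam * t) + c₂ * sin (lam * t) with hu_def
  set v : ℝ → ℝ := fun t => lam * (c₂ * cos (lam * t) - c₁ * sin (lam * t)) with hv_def
  have hlin (x : ℝ) : HasDerivAt (fun t => lam * t) lam x := by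
    simpa using (hasDerivAt_id x).const_mul lam
  have hu (x : ℝ) : HasDerivAt u (v x) x := by
    refine HasDerivAt.congr_deriv (((hlin x).cos.const_mul c₁).add ((hlin x).sin.const_mul c₂)) ?_
    simp only [hv_def]
    ring
  have hv (x : ℝ) : HasDerivAt v (-(lam ^ 2) * u x) x := by
    refine HasDerivAt.congr_deriv ((((hlin x).cos.const_mul c₂).sub ((hlin x).sin.const_mul c₁)).const_mul lam) ?_
    simp only [hu_def]
    ring
  have hyu : ∀ x ∈ Ioo (0 : ℝ) π,
      y x = -(lam ^ 2) * u x + sin x * (x * v x - u x) / (x * cos x - sin x) := by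
    intro x hx
    have hw := hne x hx
    simp only [hy, hu_def, hv_def]
    field_simp
    ring
  have hnhds {x : ℝ} (hx : x ∈ Ioo (0 : ℝ) π) := isOpen_Ioo.mem_nhds hx
  have hy' : ∀ x ∈ Ioo (0 : ℝ) π, HasDerivAt y
      (-(lam ^ 2) * v x + (x - sin x * cos x) * (x * v x - u x) / (x * cos x - sin x) ^ 2
        - lam ^ 2 * (x * sin x * u x) / (x * cos x - sin x)) x := fun x hx =>
    (hasDerivAt_transformed (hu x) (hv x) (hne x hx)).congr_of_eventuallyEq
      (Filter.eventuallyEq_of_mem (hnhds hx) hyu)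
  have hy'' : ∀ x ∈ Ioo (0 : ℝ) π, HasDerivAt (deriv y)
      (-((lam ^ 2 - 2 * (x ^ 2 - sin x ^ 2) / (x * cos x - sin x) ^ 2) * y x)) x := by
    intro x hx
    rw [hyu x hx]
    exact (hasDerivAt_deriv_transformed (hu x) (hv x) (hne x hx)).congr_of_eventuallyEq
      (Filter.eventuallyEq_of_mem (hnhds hx) fun z hz => (hy' z hz).deriv)
  refine ⟨fun x hx => (hy' x hx).differentiableAt, fun x hx => (hy'' x hx).differentiableAt,
    fun x hx => ?_⟩
  rw [(hy'' x hx).deriv]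
  exact neg_add_cancel _
end
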